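/- arXiv:1512.09005 — 9 statements merged into one kernel-verified Lean document; each statement's English description precedes it below -/
import Mathlib

section
/- Let k be an algebraically closed field and let V₁, V₂, V₃, V₄ be 2-dimensional linear subspaces of k⁴ with V_i ∩ V_j = {0} for all i ≠ j (four pairwise skew lines in P³). Then there exists a 2-dimensional linear subspace W ⊆ k⁴ with W ∩ V_i ≠ {0} for every i = 1, 2, 3, 4; that is, there exists a line in P³ meeting all four given lines. -/
namespace Submodule

variable {k E : Type*} [Field k] [AddCommGroup E] [Module k E]

/-- The projection onto `p` along a complement `q` identifies `p` with any subspace `r` of the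
same dimension that is disjoint from `q`. -/
noncomputable def projectionOntoEquiv [FiniteDimensional k E] {p q : Submodule k E}
    (h : IsCompl p q) (r : Submodule k E) (hr : Disjoint r q)
    (hdim : Module.finrank k r = Module.finrank k p) : r ≃ₗ[k] p :=
  LinearEquiv.ofInjectiveOfFinrankEq (p.projectionOnto q h ∘ₗ r.subtype)
    (by
      rw [← LinearMap.ker_eq_bot, LinearMap.ker_comp, ker_projectionOnto]
      exact disjoint_iff_comap_eq_bot.mp hr)
    hdim

theorem finrank_span_pair_of_disjoint {p q : Submodule k E} (h : Disjoint p q) {a b : E}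
    (ha : a ∈ p) (hb : b ∈ q) (ha0 : a ≠ 0) (hb0 : b ≠ 0) :
    Module.finrank k (span k {a, b}) = 2 := by
  have hli : LinearIndependent k ![a, b] := by
    rw [LinearIndependent.pair_iff' ha0]
    rintro c rfl
    exact hb0 (disjoint_def.mp h _ (p.smul_mem c ha) hb)
  rw [← Matrix.range_cons_cons_empty a b ![], finrank_span_eq_card hli, Fintype.card_fin]

theorem inf_ne_bot_of_mem {p q : Submodule k E} {x : E} (hp : x ∈ p) (hq : x ∈ q) (hx : x ≠ 0) :
    p ⊓ q ≠ ⊥ :=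
  (Submodule.ne_bot_iff _).mpr ⟨x, ⟨hp, hq⟩, hx⟩

end Submodule

/-- **Existence of a transversal to four pairwise skew lines.**
Let `k` be an algebraically closed field and let `V 0, …, V 3` be four 2-dimensional linear
subspaces of `k⁴` with `V i ⊓ V j = ⊥` for `i ≠ j` (four pairwise skew lines in `ℙ³`).
Then there is a 2-dimensional subspace `W ⊆ k⁴` with `W ⊓ V i ≠ ⊥` for every `i`,
i.e. a line in `ℙ³` meeting all four given lines. -/
theorem exists_transversal_line
    (k : Type*) [Field k] [IsAlgClosed k]
    (V : Fin 4 → Submodule k (Fin 4 → k))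
    (hdim : ∀ i, Module.finrank k (V i) = 2)
    (hskew : ∀ i j, i ≠ j → V i ⊓ V j = ⊥) :
    ∃ W : Submodule k (Fin 4 → k),
      Module.finrank k W = 2 ∧ ∀ i, W ⊓ V i ≠ ⊥ := by
  have hdisj : ∀ i j, i ≠ j → Disjoint (V i) (V j) := fun i j hij =>
    disjoint_iff.mpr (hskew i j hij)
  have hfin : ∀ i j, Module.finrank k (V i) = Module.finrank k (V j) := fun i j =>
    (hdim i).trans (hdim j).symm
  have h01 : IsCompl (V 0) (V 1) :=
    (Submodule.isCompl_iff_disjoint _ _ (by simp [hdim])).mpr (hdisj 0 1 (by decide))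
  let A₂ := Submodule.projectionOntoEquiv h01 (V 2) (hdisj 2 1 (by decide)) (hfin 2 0)
  let A₃ := Submodule.projectionOntoEquiv h01 (V 3) (hdisj 3 1 (by decide)) (hfin 3 0)
  let B₂ := Submodule.projectionOntoEquiv h01.symm (V 2) (hdisj 2 0 (by decide)) (hfin 2 1)
  let B₃ := Submodule.projectionOntoEquiv h01.symm (V 3) (hdisj 3 0 (by decide)) (hfin 3 1)
  have hsum₂ (x : V 2) : (A₂ x : Fin 4 → k) + B₂ x = x :=
    Submodule.projection_add_projection_eq_self h01 x
  have hsum₃ (x : V 3) : (A₃ x : Fin 4 → k) + B₃ x = x :=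
    Submodule.projection_add_projection_eq_self h01 x
  have : Nontrivial (V 2) := Module.nontrivial_of_finrank_pos (R := k) (by simp [hdim])
  obtain ⟨c, hc⟩ := Module.End.exists_eigenvalue
    ((B₂.trans B₃.symm).trans (A₃.trans A₂.symm) : V 2 →ₗ[k] V 2)
  obtain ⟨u, hu⟩ := hc.exists_hasEigenvector
  have hu0 : u ≠ 0 := hu.2
  set w : V 3 := B₃.symm (B₂ u) with hw
  have hBw : B₃ w = B₂ u := B₃.apply_symm_apply _
  have hAw : A₃ w = c • A₂ u := by
    rw [← map_smul, ← A₂.symm_apply_eq]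
    exact hu.apply_eq_smul
  have hw0 : w ≠ 0 := by simpa [hw] using hu0
  let a : Fin 4 → k := A₂ u
  let b : Fin 4 → k := B₂ u
  have ha0 : a ≠ 0 := by simpa [a] using hu0
  have hb0 : b ≠ 0 := by simpa [b] using hu0
  have ha : a ∈ Submodule.span k {a, b} := Submodule.subset_span (by simp)
  have hb : b ∈ Submodule.span k {a, b} := Submodule.subset_span (by simp)
  have huW : (u : Fin 4 → k) ∈ Submodule.span k {a, b} := by
    rw [← hsum₂ u]
    exact add_mem ha hb
  have hwW : (w : Fin 4 → k) ∈ Submodule.span k {a, b} := by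
    rw [← hsum₃ w, hAw, hBw]
    exact add_mem (Submodule.smul_mem _ c ha) hb
  refine ⟨Submodule.span k {a, b},
    Submodule.finrank_span_pair_of_disjoint h01.disjoint (A₂ u).2 (B₂ u).2 ha0 hb0, fun i => ?_⟩
  fin_cases i
  · exact Submodule.inf_ne_bot_of_mem ha (A₂ u).2 ha0
  · exact Submodule.inf_ne_bot_of_mem hb (B₂ u).2 hb0
  · exact Submodule.inf_ne_bot_of_mem huW u.2 (by simpa using hu0)
  · exact Submodule.inf_ne_bot_of_mem hwW w.2 (by simpa using hw0)
end

section
/- There exist four 2-dimensional linear subspaces V₁, V₂, V₃, V₄ of ℂ⁴ with V_i ∩ V_j = {0} for all i ≠ j, such that the set { W ⊆ ℂ⁴ : W is a 2-dimensional linear subspace and W ∩ V_i ≠ {0} for every i = 1, 2, 3, 4 } has exactly two elements. -/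
lemma LinearIndependent.finrank_span_pair {K E : Type*} [Field K] [AddCommGroup E]
    [Module K E] {p q : E} (h : LinearIndependent K ![p, q]) :
    Module.finrank K (Submodule.span K {p, q}) = 2 := by
  rw [← Matrix.range_cons_cons_empty p q ![], finrank_span_eq_card h, Fintype.card_fin]

/-- Two independent vectors of a plane span it. -/
lemma Submodule.span_pair_eq_of_finrank_eq_two {K E : Type*} [Field K] [AddCommGroup E]
    [Module K E] {W : Submodule K E} (hW : Module.finrank K W = 2) {p q : E}
    (hp : p ∈ W) (hq : q ∈ W) (h : LinearIndependent K ![p, q]) :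
    Submodule.span K {p, q} = W := by
  have : FiniteDimensional K W := Module.finite_of_finrank_eq_succ hW
  refine Submodule.eq_of_le_of_finrank_eq (Submodule.span_le.2 ?_) ?_
  · rintro x (rfl | rfl) <;> assumption
  · rw [hW, h.finrank_span_pair]

/-- A plane in `K⁴` meeting `⟨e₀, e₁⟩`, `⟨e₂, e₃⟩`, `⟨e₀ + e₂, e₁ + e₃⟩` and
`⟨e₀ + 2 • e₂, e₁ + 3 • e₃⟩` is `⟨e₀, e₂⟩` or `⟨e₁, e₃⟩`. -/
lemma eq_span_of_meets_four_lines {K : Type*} [Field K] {W : Submodule K (Fin 4 → K)}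
    (hW : Module.finrank K W = 2)
    (h₀ : W ⊓ Submodule.span K {![1, 0, 0, 0], ![0, 1, 0, 0]} ≠ ⊥)
    (h₁ : W ⊓ Submodule.span K {![0, 0, 1, 0], ![0, 0, 0, 1]} ≠ ⊥)
    (h₂ : W ⊓ Submodule.span K {![1, 0, 1, 0], ![0, 1, 0, 1]} ≠ ⊥)
    (h₃ : W ⊓ Submodule.span K {![1, 0, 2, 0], ![0, 1, 0, 3]} ≠ ⊥) :
    W = Submodule.span K {![1, 0, 0, 0], ![0, 0, 1, 0]} ∨
      W = Submodule.span K {![0, 1, 0, 0], ![0, 0, 0, 1]} := by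
  obtain ⟨p, ⟨hpW, hp⟩, hp0⟩ := Submodule.exists_mem_ne_zero_of_ne_bot h₀
  obtain ⟨q, ⟨hqW, hq⟩, hq0⟩ := Submodule.exists_mem_ne_zero_of_ne_bot h₁
  obtain ⟨r, ⟨hrW, hr⟩, hr0⟩ := Submodule.exists_mem_ne_zero_of_ne_bot h₂
  obtain ⟨z, ⟨hzW, hz⟩, hz0⟩ := Submodule.exists_mem_ne_zero_of_ne_bot h₃
  obtain ⟨a, b, rfl⟩ := Submodule.mem_span_pair.1 hp
  obtain ⟨c, d, rfl⟩ := Submodule.mem_span_pair.1 hq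
  obtain ⟨e, f, rfl⟩ := Submodule.mem_span_pair.1 hr
  obtain ⟨g, h, rfl⟩ := Submodule.mem_span_pair.1 hz
  have hspan := Submodule.span_pair_eq_of_finrank_eq_two hW hpW hqW <| by
    rw [LinearIndependent.pair_iff]
    intro s t hst
    simp [funext_iff, Fin.forall_fin_succ] at hst hp0 hq0
    grind
  rw [← hspan] at hrW hzW
  obtain ⟨s, t, hst⟩ := Submodule.mem_span_pair.1 hrW
  obtain ⟨s', t', hst'⟩ := Submodule.mem_span_pair.1 hzW
  simp [funext_iff, Fin.forall_fin_succ] at hst hst' hp0 hq0 hr0 hz0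
  obtain ⟨h1, h2, h3, h4⟩ := hst
  obtain ⟨k1, k2, k3, k4⟩ := hst'
  have hs : s ≠ 0 := by grind
  have hs' : s' ≠ 0 := by grind
  have had : a * d = b * c := by
    have : s * (a * d - b * c) = 0 := by grind
    grind
  have had0 : a * d = 0 := by
    have : s' * (a * d) = 0 := by grind
    grind
  rw [← hspan]
  rcases mul_eq_zero.1 had0 with rfl | rfl
  · have hb : b ≠ 0 := by grind
    obtain rfl : c = 0 := by grind
    have hd : d ≠ 0 := by grind
    right
    rw [zero_smul, zero_smul, zero_add, zero_add, Submodule.span_insert, Submodule.span_insert,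
      Submodule.span_singleton_smul_eq hb.isUnit, Submodule.span_singleton_smul_eq hd.isUnit]
  · have hc : c ≠ 0 := by grind
    obtain rfl : b = 0 := by grind
    have ha : a ≠ 0 := by grind
    left
    rw [zero_smul, zero_smul, add_zero, add_zero, Submodule.span_insert, Submodule.span_insert,
      Submodule.span_singleton_smul_eq ha.isUnit, Submodule.span_singleton_smul_eq hc.isUnit]

/-- **Four general lines in `ℙ³` have exactly two transversals.**
There exist four 2-dimensional linear subspaces `V 0, …, V 3` of `ℂ⁴`, pairwise meeting in `0`,
such that the set of 2-dimensional subspaces `W ⊆ ℂ⁴` with `W ⊓ V i ≠ ⊥` for every `i`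
has exactly two elements. -/
theorem four_general_lines_two_transversals :
    ∃ V : Fin 4 → Submodule ℂ (Fin 4 → ℂ),
      (∀ i, Module.finrank ℂ (V i) = 2) ∧
      (∀ i j, i ≠ j → V i ⊓ V j = ⊥) ∧
      ∃ W₁ W₂ : Submodule ℂ (Fin 4 → ℂ), W₁ ≠ W₂ ∧
        {W : Submodule ℂ (Fin 4 → ℂ) |
          Module.finrank ℂ W = 2 ∧ ∀ i, W ⊓ V i ≠ ⊥} = {W₁, W₂} := by
  refine ⟨![.span ℂ {![1, 0, 0, 0], ![0, 1, 0, 0]}, .span ℂ {![0, 0, 1, 0], ![0, 0, 0, 1]},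
    .span ℂ {![1, 0, 1, 0], ![0, 1, 0, 1]}, .span ℂ {![1, 0, 2, 0], ![0, 1, 0, 3]}], ?_, ?_,
    .span ℂ {![1, 0, 0, 0], ![0, 0, 1, 0]}, .span ℂ {![0, 1, 0, 0], ![0, 0, 0, 1]}, ?_, ?_⟩
  · intro i
    fin_cases i <;>
    · refine LinearIndependent.finrank_span_pair (LinearIndependent.pair_iff.2 fun s t hst => ?_)
      simp [funext_iff, Fin.forall_fin_succ] at hst
      grind
  · intro i j hij
    rw [Submodule.eq_bot_iff]
    rintro x ⟨hi, hj⟩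
    fin_cases i <;> fin_cases j <;> first
    | exact absurd rfl hij
    | obtain ⟨a, b, rfl⟩ := Submodule.mem_span_pair.1 hi
      obtain ⟨c, d, h⟩ := Submodule.mem_span_pair.1 hj
      simp [funext_iff, Fin.forall_fin_succ] at h ⊢
      grind
  · intro h
    have : (![1, 0, 0, 0] : Fin 4 → ℂ) ∈ Submodule.span ℂ {![0, 1, 0, 0], ![0, 0, 0, 1]} :=
      h ▸ Submodule.subset_span (by simp)
    simp [Submodule.mem_span_pair] at this
  · ext W
    constructor
    · rintro ⟨hW, h⟩
      exact eq_span_of_meets_four_lines hW (h 0) (h 1) (h 2) (h 3)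
    · rintro (rfl | rfl)
      · refine ⟨LinearIndependent.finrank_span_pair (LinearIndependent.pair_iff.2 ?_), ?_⟩
        · intro s t hst
          simpa [funext_iff, Fin.forall_fin_succ] using hst
        have meets {V : Submodule ℂ (Fin 4 → ℂ)} {c d : ℂ} (hcd : ![c, 0, d, 0] ∈ V)
            (h0 : c ≠ 0 ∨ d ≠ 0) :
            Submodule.span ℂ {![1, 0, 0, 0], ![0, 0, 1, 0]} ⊓ V ≠ ⊥ :=
          (Submodule.ne_bot_iff _).2 ⟨_, ⟨Submodule.mem_span_pair.2 ⟨c, d, by simp⟩, hcd⟩,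
            fun h => by simp [funext_iff, Fin.forall_fin_succ] at h; tauto⟩
        intro i
        fin_cases i
        · exact meets (c := 1) (d := 0) (Submodule.subset_span (by simp)) (by simp)
        · exact meets (c := 0) (d := 1) (Submodule.subset_span (by simp)) (by simp)
        · exact meets (c := 1) (d := 1) (Submodule.subset_span (by simp)) (by simp)
        · exact meets (c := 1) (d := 2) (Submodule.subset_span (by simp)) (by simp)
      · refine ⟨LinearIndependent.finrank_span_pair (LinearIndependent.pair_iff.2 ?_), ?_⟩
        · intro s t hst
          simpa [funext_iff, Fin.forall_fin_succ] using hst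
        have meets {V : Submodule ℂ (Fin 4 → ℂ)} {c d : ℂ} (hcd : ![0, c, 0, d] ∈ V)
            (h0 : c ≠ 0 ∨ d ≠ 0) :
            Submodule.span ℂ {![0, 1, 0, 0], ![0, 0, 0, 1]} ⊓ V ≠ ⊥ :=
          (Submodule.ne_bot_iff _).2 ⟨_, ⟨Submodule.mem_span_pair.2 ⟨c, d, by simp⟩, hcd⟩,
            fun h => by simp [funext_iff, Fin.forall_fin_succ] at h; tauto⟩
        intro i
        fin_cases i
        · exact meets (c := 1) (d := 0) (Submodule.subset_span (by simp)) (by simp)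
        · exact meets (c := 0) (d := 1) (Submodule.subset_span (by simp)) (by simp)
        · exact meets (c := 1) (d := 1) (Submodule.subset_span (by simp)) (by simp)
        · exact meets (c := 1) (d := 3) (Submodule.subset_span (by simp)) (by simp)
end

section
/- There exist five 2-dimensional linear subspaces V₁, …, V₅ of ℂ⁴ with V_i ∩ V_j = {0} for all i ≠ j, such that the only homogeneous polynomial of degree 3 in ℂ[x₀,x₁,x₂,x₃] vanishing at every point of V₁ ∪ ⋯ ∪ V₅ is the zero polynomial. -/
theorem MvPolynomial.IsHomogeneous.mem_antidiagonalTuple {R : Type*} [CommSemiring R]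
    {k n : ℕ} {F : MvPolynomial (Fin k) R} (hF : F.IsHomogeneous n) {d : Fin k →₀ ℕ}
    (hd : F.coeff d ≠ 0) : ⇑d ∈ Finset.Nat.antidiagonalTuple k n := by
  rw [Finset.Nat.mem_antidiagonalTuple, ← hF hd, Finsupp.weight_apply]
  simp [Finsupp.sum_fintype]

/-- A homogeneous polynomial is evaluated by summing over all exponents of its degree. -/
theorem MvPolynomial.IsHomogeneous.eval_eq_sum_antidiagonalTuple {R : Type*} [CommSemiring R]
    {k n : ℕ} {F : MvPolynomial (Fin k) R} (hF : F.IsHomogeneous n) (v : Fin k → R) :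
    MvPolynomial.eval v F = ∑ d ∈ Finset.Nat.antidiagonalTuple k n,
      F.coeff (Finsupp.equivFunOnFinite.symm d) * ∏ i, v i ^ d i := by
  rw [MvPolynomial.eval_eq']
  refine Finset.sum_of_injOn (fun d => ⇑d) DFunLike.coe_injective.injOn (fun d hd => ?_)
    (fun d _ hd => ?_) fun d _ => ?_
  · exact hF.mem_antidiagonalTuple (MvPolynomial.mem_support_iff.mp hd)
  · rw [MvPolynomial.notMem_support_iff.mp fun h => hd ⟨_, h, rfl⟩, zero_mul]
  · simp

/-- The parametrizations of five lines in `P³` that lie on no common cubic surface. -/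
def fiveLines : Fin 5 → Matrix (Fin 4) (Fin 2) ℂ :=
  ![!![1, 0; 0, 1; 0, 0; 0, 0],
    !![0, 0; 0, 0; 1, 0; 0, 1],
    !![1, 0; 0, 1; 1, 0; 0, 1],
    !![1, 0; 0, 1; 0, -1; 1, 0],
    !![1, 0; 0, 1; 0, 2; -1, 0]]

theorem fiveLines_injective (i : Fin 5) : Function.Injective (fiveLines i).mulVecLin := by
  rw [← LinearMap.ker_eq_bot, LinearMap.ker_eq_bot']
  intro x hx
  have h := fun j => congrFun hx j
  fin_cases i <;>
    simp [fiveLines, Matrix.mulVec, dotProduct, Fin.forall_fin_succ] at h <;>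
    ext j <;> fin_cases j <;> simp [h]

theorem fiveLines_mulVec_zero (s t : ℂ) : (fiveLines 0).mulVec ![s, t] = ![s, t, 0, 0] := by
  ext l
  fin_cases l <;> simp [fiveLines, Matrix.mulVec, dotProduct, mul_comm]

theorem fiveLines_mulVec_one (s t : ℂ) : (fiveLines 1).mulVec ![s, t] = ![0, 0, s, t] := by
  ext l
  fin_cases l <;> simp [fiveLines, Matrix.mulVec, dotProduct, mul_comm]

theorem fiveLines_mulVec_two (s t : ℂ) : (fiveLines 2).mulVec ![s, t] = ![s, t, s, t] := by
  ext l
  fin_cases l <;> simp [fiveLines, Matrix.mulVec, dotProduct, mul_comm]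

theorem fiveLines_mulVec_three (s t : ℂ) : (fiveLines 3).mulVec ![s, t] = ![s, t, -t, s] := by
  ext l
  fin_cases l <;> simp [fiveLines, Matrix.mulVec, dotProduct, mul_comm]

theorem fiveLines_mulVec_four (s t : ℂ) : (fiveLines 4).mulVec ![s, t] = ![s, t, 2 * t, -s] := by
  ext l
  fin_cases l <;> simp [fiveLines, Matrix.mulVec, dotProduct, mul_comm]

/-- Equations of the lines parametrized by `fiveLines`. -/
def fiveLinesEquations : Fin 5 → Matrix (Fin 2) (Fin 4) ℂ :=
  ![!![0, 0, 1, 0; 0, 0, 0, 1],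
    !![1, 0, 0, 0; 0, 1, 0, 0],
    !![1, 0, -1, 0; 0, 1, 0, -1],
    !![0, 1, 1, 0; 1, 0, 0, -1],
    !![0, 2, -1, 0; 1, 0, 0, 1]]

theorem fiveLinesEquations_mul_self (i : Fin 5) : fiveLinesEquations i * fiveLines i = 0 := by
  fin_cases i <;> simp [fiveLinesEquations, fiveLines, ← Matrix.ext_iff, Fin.forall_fin_two]

theorem det_fiveLinesEquations_mul_ne_zero {i j : Fin 5} (hij : i ≠ j) :
    (fiveLinesEquations i * fiveLines j).det ≠ 0 := by
  fin_cases i <;> fin_cases j <;> first | exact absurd rfl hij | skip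
  all_goals
    simp [fiveLinesEquations, fiveLines, Matrix.det_fin_two]
    try norm_num

theorem fiveLines_disjoint {i j : Fin 5} (hij : i ≠ j) :
    LinearMap.range (fiveLines i).mulVecLin ⊓ LinearMap.range (fiveLines j).mulVecLin = ⊥ := by
  rw [Submodule.eq_bot_iff]
  rintro _ ⟨⟨x, rfl⟩, y, hy⟩
  have h : (fiveLinesEquations j * fiveLines i).mulVec x = 0 := by
    rw [Matrix.mulVecLin_apply, Matrix.mulVecLin_apply] at hy
    rw [← Matrix.mulVec_mulVec, ← hy, Matrix.mulVec_mulVec, fiveLinesEquations_mul_self,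
      Matrix.zero_mulVec]
  rw [Matrix.eq_zero_of_mulVec_eq_zero (det_fiveLinesEquations_mul_ne_zero hij.symm) h, map_zero]

theorem antidiagonalTuple_four_three : Finset.Nat.antidiagonalTuple 4 3 =
    {![0, 0, 0, 3], ![0, 0, 1, 2], ![0, 0, 2, 1], ![0, 0, 3, 0], ![0, 1, 0, 2],
     ![0, 1, 1, 1], ![0, 1, 2, 0], ![0, 2, 0, 1], ![0, 2, 1, 0], ![0, 3, 0, 0],
     ![1, 0, 0, 2], ![1, 0, 1, 1], ![1, 0, 2, 0], ![1, 1, 0, 1], ![1, 1, 1, 0],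
     ![1, 2, 0, 0], ![2, 0, 0, 1], ![2, 0, 1, 0], ![2, 1, 0, 0], ![3, 0, 0, 0]} := by
  decide

theorem sum_antidiagonalTuple_four_three {R : Type*} [CommSemiring R] (c : (Fin 4 → ℕ) → R)
    (v : Fin 4 → R) : ∑ d ∈ Finset.Nat.antidiagonalTuple 4 3, c d * ∏ l, v l ^ d l =
      c ![0, 0, 0, 3] * (v 3 ^ 3) + c ![0, 0, 1, 2] * (v 2 * v 3 ^ 2) +
      c ![0, 0, 2, 1] * (v 2 ^ 2 * v 3) + c ![0, 0, 3, 0] * (v 2 ^ 3) +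
      c ![0, 1, 0, 2] * (v 1 * v 3 ^ 2) + c ![0, 1, 1, 1] * (v 1 * v 2 * v 3) +
      c ![0, 1, 2, 0] * (v 1 * v 2 ^ 2) + c ![0, 2, 0, 1] * (v 1 ^ 2 * v 3) +
      c ![0, 2, 1, 0] * (v 1 ^ 2 * v 2) + c ![0, 3, 0, 0] * (v 1 ^ 3) +
      c ![1, 0, 0, 2] * (v 0 * v 3 ^ 2) + c ![1, 0, 1, 1] * (v 0 * v 2 * v 3) +
      c ![1, 0, 2, 0] * (v 0 * v 2 ^ 2) + c ![1, 1, 0, 1] * (v 0 * v 1 * v 3) +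
      c ![1, 1, 1, 0] * (v 0 * v 1 * v 2) + c ![1, 2, 0, 0] * (v 0 * v 1 ^ 2) +
      c ![2, 0, 0, 1] * (v 0 ^ 2 * v 3) + c ![2, 0, 1, 0] * (v 0 ^ 2 * v 2) +
      c ![2, 1, 0, 0] * (v 0 ^ 2 * v 1) + c ![3, 0, 0, 0] * (v 0 ^ 3) := by
  rw [antidiagonalTuple_four_three]
  iterate 19 rw [Finset.sum_insert (by decide)]
  rw [Finset.sum_singleton]
  simp only [Fin.prod_univ_four, Matrix.cons_val, pow_zero, pow_one, one_mul, mul_one, add_assoc]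

theorem binary_cubic_coeff_eq_zero {p q r u : ℂ}
    (h : ∀ s t : ℂ, p * s ^ 3 + q * (s ^ 2 * t) + r * (s * t ^ 2) + u * t ^ 3 = 0) :
    p = 0 ∧ q = 0 ∧ r = 0 ∧ u = 0 := by
  have h1 := h 1 0
  have h2 := h 0 1
  have h3 := h 1 1
  have h4 := h 1 (-1)
  grind

/-- A cubic form vanishing on each of the five lines has no nonzero coefficient. -/
theorem cubic_coeff_eq_zero (c : (Fin 4 → ℕ) → ℂ)
    (hc : ∀ i x, ∑ d ∈ Finset.Nat.antidiagonalTuple 4 3,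
      c d * ∏ l, (fiveLines i).mulVec x l ^ d l = 0) :
    ∀ d ∈ Finset.Nat.antidiagonalTuple 4 3, c d = 0 := by
  have h0 (s t : ℂ) := hc 0 ![s, t]
  have h1 (s t : ℂ) := hc 1 ![s, t]
  have h2 (s t : ℂ) := hc 2 ![s, t]
  have h3 (s t : ℂ) := hc 3 ![s, t]
  have h4 (s t : ℂ) := hc 4 ![s, t]
  clear hc
  simp only [sum_antidiagonalTuple_four_three, fiveLines_mulVec_zero, fiveLines_mulVec_one,
    fiveLines_mulVec_two, fiveLines_mulVec_three, fiveLines_mulVec_four, Matrix.cons_val]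
    at h0 h1 h2 h3 h4
  simp only [antidiagonalTuple_four_three, Finset.forall_mem_insert, Finset.mem_singleton,
    forall_eq]
  obtain ⟨e00, e01, e02, e03⟩ := binary_cubic_coeff_eq_zero
    (p := c ![3, 0, 0, 0])
    (q := c ![2, 1, 0, 0])
    (r := c ![1, 2, 0, 0])
    (u := c ![0, 3, 0, 0])
    fun s t => by linear_combination h0 s t
  obtain ⟨e10, e11, e12, e13⟩ := binary_cubic_coeff_eq_zero
    (p := c ![0, 0, 3, 0])
    (q := c ![0, 0, 2, 1])
    (r := c ![0, 0, 1, 2])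
    (u := c ![0, 0, 0, 3])
    fun s t => by linear_combination h1 s t
  simp only [e00, e01, e02, e03, e10, e11, e12, e13, zero_mul, zero_add, add_zero,
    true_and, and_true] at h2 h3 h4 ⊢
  obtain ⟨e20, e21, e22, e23⟩ := binary_cubic_coeff_eq_zero
    (p := c ![1, 0, 2, 0] + c ![2, 0, 1, 0])
    (q := c ![0, 1, 2, 0] + c ![1, 0, 1, 1] + c ![1, 1, 1, 0] + c ![2, 0, 0, 1])
    (r := c ![0, 1, 1, 1] + c ![0, 2, 1, 0] + c ![1, 0, 0, 2] + c ![1, 1, 0, 1])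
    (u := c ![0, 1, 0, 2] + c ![0, 2, 0, 1])
    fun s t => by linear_combination h2 s t
  obtain ⟨e30, e31, e32, e33⟩ := binary_cubic_coeff_eq_zero
    (p := c ![1, 0, 0, 2] + c ![2, 0, 0, 1])
    (q := c ![0, 1, 0, 2] - c ![1, 0, 1, 1] + c ![1, 1, 0, 1] - c ![2, 0, 1, 0])
    (r := -c ![0, 1, 1, 1] + c ![0, 2, 0, 1] + c ![1, 0, 2, 0] - c ![1, 1, 1, 0])
    (u := c ![0, 1, 2, 0] - c ![0, 2, 1, 0])
    fun s t => by linear_combination h3 s t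
  obtain ⟨e40, e41, e42, e43⟩ := binary_cubic_coeff_eq_zero
    (p := c ![1, 0, 0, 2] - c ![2, 0, 0, 1])
    (q := c ![0, 1, 0, 2] - 2 * c ![1, 0, 1, 1] - c ![1, 1, 0, 1] + 2 * c ![2, 0, 1, 0])
    (r := -2 * c ![0, 1, 1, 1] - c ![0, 2, 0, 1] + 4 * c ![1, 0, 2, 0] + 2 * c ![1, 1, 1, 0])
    (u := 4 * c ![0, 1, 2, 0] + 2 * c ![0, 2, 1, 0])
    fun s t => by linear_combination h4 s t
  clear h0 h1 h2 h3 h4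
  grind

/-- **No cubic surface contains five general lines (Lemma 5.4).**
There exist five 2-dimensional linear subspaces `V 0, …, V 4` of `ℂ⁴`, pairwise meeting in `0`,
such that the only homogeneous polynomial of degree 3 in `ℂ[x₀,x₁,x₂,x₃]` vanishing at every
point of `V 0 ∪ ⋯ ∪ V 4` is the zero polynomial. -/
theorem no_cubic_through_five_general_lines :
    ∃ V : Fin 5 → Submodule ℂ (Fin 4 → ℂ),
      (∀ i, Module.finrank ℂ (V i) = 2) ∧
      (∀ i j, i ≠ j → V i ⊓ V j = ⊥) ∧
      ∀ F : MvPolynomial (Fin 4) ℂ, F.IsHomogeneous 3 →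
        (∀ i, ∀ v ∈ V i, MvPolynomial.eval v F = 0) → F = 0 := by
  refine ⟨fun i => LinearMap.range (fiveLines i).mulVecLin, fun i => ?_,
    fun i j => fiveLines_disjoint, fun F hF h => ?_⟩
  · simp [LinearMap.finrank_range_of_inj (fiveLines_injective i)]
  · have hc := cubic_coeff_eq_zero (fun d => F.coeff (Finsupp.equivFunOnFinite.symm d))
      fun i x => by
        rw [← hF.eval_eq_sum_antidiagonalTuple]
        exact h i _ ⟨x, rfl⟩
    ext d
    by_contra hd
    refine hd ?_
    rw [← Finsupp.equivFunOnFinite_symm_coe d]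
    exact hc d (hF.mem_antidiagonalTuple hd)
end

section
/- Let k be a field and let ℓ₁, ℓ₂, ℓ₃, ℓ₄ be four linearly independent linear forms on k⁴. Let F ∈ k[x₀,x₁,x₂,x₃] be a nonzero homogeneous polynomial of degree d with F ∈ (ℓ₁, ℓ₂)^{m₁} and F ∈ (ℓ₃, ℓ₄)^{m₂}, where (ℓ₁, ℓ₂) and (ℓ₃, ℓ₄) denote the ideals generated by the indicated linear forms and m₁, m₂ are natural numbers. Then m₁ + m₂ ≤ d. -/
namespace MvPolynomial

variable {σ R : Type*} [CommSemiring R]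

/-- The polynomials all of whose monomials have weight at least `n` form an ideal. -/
def weightGeIdeal (w : σ → ℕ) (n : ℕ) : Ideal (MvPolynomial σ R) where
  carrier := {p | ∀ s ∈ p.support, n ≤ Finsupp.weight w s}
  zero_mem' := by simp
  add_mem' := by
    classical
    intro p q hp hq s hs
    exact (Finset.mem_union.mp (support_add hs)).elim (hp s) (hq s)
  smul_mem' := by
    classical
    intro p q hq s hs
    obtain ⟨a, -, b, hb, rfl⟩ := Finset.mem_add.mp (support_mul p q hs)
    rw [map_add]
    exact (hq b hb).trans (Nat.le_add_left _ _)

theorem mem_weightGeIdeal {w : σ → ℕ} {n : ℕ} {p : MvPolynomial σ R} :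
    p ∈ weightGeIdeal w n ↔ ∀ s ∈ p.support, n ≤ Finsupp.weight w s :=
  Iff.rfl

theorem X_mem_weightGeIdeal (w : σ → ℕ) (i : σ) :
    (X i : MvPolynomial σ R) ∈ weightGeIdeal w (w i) := by
  intro s hs
  obtain rfl : s = Finsupp.single i 1 := by
    simpa using support_monomial_subset hs
  simp [Finsupp.weight_single]

theorem pow_weightGeIdeal_one_le (w : σ → ℕ) (n : ℕ) :
    (weightGeIdeal w 1 : Ideal (MvPolynomial σ R)) ^ n ≤ weightGeIdeal w n := by
  classical
  induction n with
  | zero => exact fun p _ s _ => Nat.zero_le _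
  | succ n ih =>
    rw [pow_succ, Ideal.mul_le]
    intro p hp q hq s hs
    obtain ⟨a, ha, b, hb, rfl⟩ := Finset.mem_add.mp (support_mul p q hs)
    rw [map_add]
    exact Nat.add_le_add (ih hp a ha) (hq b hb)

/-- A linearly independent family of linear forms of full cardinality is carried to the variables
by an injective algebra endomorphism preserving degrees. -/
theorem exists_algHom_apply_eq_X {ι k : Type*} [Fintype ι] [Field k]
    {ℓ : ι → MvPolynomial ι k} (hℓ : ∀ i, (ℓ i).IsHomogeneous 1) (hli : LinearIndependent k ℓ) :
    ∃ φ : MvPolynomial ι k →ₐ[k] MvPolynomial ι k, Function.Injective φ ∧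
      (∀ i, φ (ℓ i) = X i) ∧ ∀ p d, p.IsHomogeneous d → (φ p).IsHomogeneous d := by
  have hspan : Submodule.span k (Set.range ℓ) =
      Submodule.span k (Set.range (X : ι → MvPolynomial ι k)) := by
    have : FiniteDimensional k (Submodule.span k (Set.range (X : ι → MvPolynomial ι k))) :=
      FiniteDimensional.span_of_finite k (Set.finite_range _)
    refine Submodule.eq_of_le_of_finrank_le ?_ ?_
    · rw [← homogeneousSubmodule_one_eq_span_X, Submodule.span_le]
      rintro _ ⟨i, rfl⟩
      exact hℓ i
    · rw [finrank_span_eq_card hli]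
      exact finrank_range_le_card X
  obtain ⟨T, hT⟩ := LinearMap.exists_extend
    ((Module.Basis.span hli).constr k (X : ι → MvPolynomial ι k))
  have hTℓ (i : ι) : T (ℓ i) = X i := by
    have := LinearMap.congr_fun hT (Module.Basis.span hli i)
    rw [Module.Basis.constr_basis] at this
    simpa [Module.Basis.span_apply] using this
  have hX (j : ι) : (X j : MvPolynomial ι k) ∈ Submodule.span k (Set.range ℓ) :=
    hspan ▸ Submodule.subset_span ⟨j, rfl⟩
  have hThom (j : ι) : (T (X j)).IsHomogeneous 1 := by
    suffices Submodule.span k (Set.range ℓ) ≤ (homogeneousSubmodule ι k 1).comap T from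
      this (hX j)
    rw [Submodule.span_le]
    rintro _ ⟨i, rfl⟩
    simpa [hTℓ] using isHomogeneous_X k i
  have hinv (j : ι) : aeval ℓ (T (X j)) = X j := by
    have : Set.EqOn ((aeval (R := k) ℓ).toLinearMap ∘ₗ T)
        (LinearMap.id (R := k) (M := MvPolynomial ι k))
        (Submodule.span k (Set.range ℓ)) := by
      refine LinearMap.eqOn_span ?_
      rintro _ ⟨i, rfl⟩
      simp [hTℓ]
    exact this (hX j)
  have hφ : Set.EqOn (aeval fun j => T (X j)).toLinearMap T
      (Submodule.span k (Set.range (X : ι → MvPolynomial ι k))) := by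
    refine LinearMap.eqOn_span ?_
    rintro _ ⟨i, rfl⟩
    simp
  refine ⟨aeval fun j => T (X j), ?_, fun i => ?_, fun p d hp => ?_⟩
  · have hcomp : (aeval ℓ).comp (aeval fun j => T (X j)) = AlgHom.id k _ :=
      algHom_ext fun j => by
        rw [AlgHom.comp_apply, aeval_X, hinv, AlgHom.id_apply]
    have hleft : Function.LeftInverse (aeval (R := k) ℓ) (aeval (R := k) fun j => T (X j)) :=
      fun p => AlgHom.congr_fun hcomp p
    exact hleft.injective
  · exact (hφ (hspan ▸ Submodule.subset_span ⟨i, rfl⟩)).trans (hTℓ i)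
  · simpa using hp.aeval _ hThom

end MvPolynomial

/-- **Multiplicities along two skew lines.**
Let `k` be a field and `ℓ₁, ℓ₂, ℓ₃, ℓ₄` four linearly independent linear forms on `k⁴`.
If `F` is a nonzero homogeneous polynomial of degree `d` with `F ∈ (ℓ₁, ℓ₂) ^ m₁` and
`F ∈ (ℓ₃, ℓ₄) ^ m₂`, then `m₁ + m₂ ≤ d`. -/
theorem mult_sum_le_deg_two_skew_lines
    (k : Type*) [Field k]
    (ℓ₁ ℓ₂ ℓ₃ ℓ₄ : MvPolynomial (Fin 4) k)
    (h₁ : ℓ₁.IsHomogeneous 1) (h₂ : ℓ₂.IsHomogeneous 1)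
    (h₃ : ℓ₃.IsHomogeneous 1) (h₄ : ℓ₄.IsHomogeneous 1)
    (hli : LinearIndependent k ![ℓ₁, ℓ₂, ℓ₃, ℓ₄])
    (d m₁ m₂ : ℕ)
    (F : MvPolynomial (Fin 4) k) (hF0 : F ≠ 0) (hFh : F.IsHomogeneous d)
    (hFm₁ : F ∈ (Ideal.span {ℓ₁, ℓ₂}) ^ m₁)
    (hFm₂ : F ∈ (Ideal.span {ℓ₃, ℓ₄}) ^ m₂) :
    m₁ + m₂ ≤ d := by
  obtain ⟨φ, hinj, hφℓ, hφh⟩ := MvPolynomial.exists_algHom_apply_eq_X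
    (ℓ := ![ℓ₁, ℓ₂, ℓ₃, ℓ₄]) (by simp [Fin.forall_fin_succ, *]) hli
  have key (w : Fin 4 → ℕ) (i j : Fin 4) (hi : w i = 1) (hj : w j = 1) (m : ℕ)
      (hF : F ∈ Ideal.span {![ℓ₁, ℓ₂, ℓ₃, ℓ₄] i, ![ℓ₁, ℓ₂, ℓ₃, ℓ₄] j} ^ m) :
      φ F ∈ MvPolynomial.weightGeIdeal w m := by
    have hle : (Ideal.span {![ℓ₁, ℓ₂, ℓ₃, ℓ₄] i, ![ℓ₁, ℓ₂, ℓ₃, ℓ₄] j}).map φ ≤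
        MvPolynomial.weightGeIdeal w 1 := by
      rw [Ideal.map_span, Ideal.span_le, Set.image_pair, hφℓ, hφℓ, Set.pair_subset_iff]
      exact ⟨hi ▸ MvPolynomial.X_mem_weightGeIdeal w i, hj ▸ MvPolynomial.X_mem_weightGeIdeal w j⟩
    refine MvPolynomial.pow_weightGeIdeal_one_le w m (Ideal.pow_right_mono hle m ?_)
    rw [← Ideal.map_pow]
    exact Ideal.mem_map_of_mem φ hF
  obtain ⟨s, hs⟩ := MvPolynomial.support_nonempty.mpr ((map_ne_zero_iff φ hinj).mpr hF0)
  have hs₁ := key ![1, 1, 0, 0] 0 1 rfl rfl m₁ hFm₁ s hs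
  have hs₂ := key ![0, 0, 1, 1] 2 3 rfl rfl m₂ hFm₂ s hs
  have hsd := hφh F d hFh (MvPolynomial.mem_support_iff.mp hs)
  simp [Finsupp.weight_apply, Finsupp.sum_fintype, Fin.sum_univ_four] at hs₁ hs₂ hsd
  omega
end

section
/- A vector (d, m₁, m₂, m₃) ∈ ℝ⁴ satisfies the inequalities 0 ≤ d, m_i ≤ d for all i ∈ {1,2,3}, and m_i + m_j ≤ d for all i ≠ j in {1,2,3}, if and only if it is a linear combination with nonnegative real coefficients of the seven vectors (0,−1,0,0), (0,0,−1,0), (0,0,0,−1), (1,1,0,0), (1,0,1,0), (1,0,0,1), (2,1,1,1). -/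
/-- **The effective cone of the blow-up of `ℙ³` along 3 general lines (Theorem 5.1 + Cor. 5.7).**
A vector `(d, m₁, m₂, m₃) ∈ ℝ⁴` satisfies `0 ≤ d`, `mᵢ ≤ d` for all `i`, and `mᵢ + mⱼ ≤ d` for
all `i ≠ j` if and only if it is a nonnegative linear combination of the seven vectors
`(0,−1,0,0)`, `(0,0,−1,0)`, `(0,0,0,−1)`, `(1,1,0,0)`, `(1,0,1,0)`, `(1,0,0,1)`, `(2,1,1,1)`. -/
theorem effective_cone_three_lines (d m₁ m₂ m₃ : ℝ) :
    (0 ≤ d ∧ m₁ ≤ d ∧ m₂ ≤ d ∧ m₃ ≤ d ∧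
      m₁ + m₂ ≤ d ∧ m₁ + m₃ ≤ d ∧ m₂ + m₃ ≤ d) ↔
    ∃ a₁ a₂ a₃ b₁ b₂ b₃ c : ℝ,
      0 ≤ a₁ ∧ 0 ≤ a₂ ∧ 0 ≤ a₃ ∧ 0 ≤ b₁ ∧ 0 ≤ b₂ ∧ 0 ≤ b₃ ∧ 0 ≤ c ∧
      (![d, m₁, m₂, m₃] : Fin 4 → ℝ) =
        a₁ • ![0, -1, 0, 0] + a₂ • ![0, 0, -1, 0] + a₃ • ![0, 0, 0, -1]
        + b₁ • ![1, 1, 0, 0] + b₂ • ![1, 0, 1, 0] + b₃ • ![1, 0, 0, 1]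
        + c • ![2, 1, 1, 1] := by
  constructor
  · rintro ⟨hd, h₁, h₂, h₃, h₁₂, h₁₃, h₂₃⟩
    obtain ⟨p₁, hp₁, hm₁, hp₁'⟩ : ∃ p, 0 ≤ p ∧ m₁ ≤ p ∧ (p = m₁ ∨ p = 0) :=
      ⟨max m₁ 0, le_max_right _ _, le_max_left _ _, max_choice _ _⟩
    obtain ⟨p₂, hp₂, hm₂, hp₂'⟩ : ∃ p, 0 ≤ p ∧ m₂ ≤ p ∧ (p = m₂ ∨ p = 0) :=
      ⟨max m₂ 0, le_max_right _ _, le_max_left _ _, max_choice _ _⟩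
    obtain ⟨p₃, hp₃, hm₃, hp₃'⟩ : ∃ p, 0 ≤ p ∧ m₃ ≤ p ∧ (p = m₃ ∨ p = 0) :=
      ⟨max m₃ 0, le_max_right _ _, le_max_left _ _, max_choice _ _⟩
    have hp₁₂ : p₁ + p₂ ≤ d := by
      rcases hp₁' with h | h <;> rcases hp₂' with h' | h' <;> linarith
    have hp₁₃ : p₁ + p₃ ≤ d := by
      rcases hp₁' with h | h <;> rcases hp₃' with h' | h' <;> linarith
    have hp₂₃ : p₂ + p₃ ≤ d := by
      rcases hp₂' with h | h <;> rcases hp₃' with h' | h' <;> linarith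
    obtain ⟨c, hc, hpc, hc₂, hc₃⟩ : ∃ c, 0 ≤ c ∧ p₁ + p₂ + p₃ - d ≤ c ∧ c ≤ p₂ ∧ c ≤ p₃ :=
      ⟨max 0 (p₁ + p₂ + p₃ - d), le_max_left _ _, le_max_right _ _,
        max_le hp₂ (by linarith), max_le hp₃ (by linarith)⟩
    refine ⟨d - p₂ - p₃ + c - m₁, p₂ - m₂, p₃ - m₃, d - p₂ - p₃, p₂ - c, p₃ - c, c,
      by linarith, by linarith, by linarith, by linarith, by linarith, by linarith, hc, ?_⟩
    ext i
    fin_cases i <;> simp <;> ring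
  · rintro ⟨a₁, a₂, a₃, b₁, b₂, b₃, c, ha₁, ha₂, ha₃, hb₁, hb₂, hb₃, hc, h⟩
    have e₀ := congrFun h 0
    have e₁ := congrFun h 1
    have e₂ := congrFun h 2
    have e₃ := congrFun h 3
    simp at e₀ e₁ e₂ e₃
    refine ⟨?_, ?_, ?_, ?_, ?_, ?_, ?_⟩ <;> linarith
end

section
/- A vector (d, m₁, m₂, m₃, m₄) ∈ ℝ⁵ satisfies the inequalities 0 ≤ d; m_i ≤ d for all i ∈ {1,…,4}; m_i + m_j ≤ d for all i ≠ j; (m₁+m₂+m₃+m₄) + m_i ≤ 2d for all i; and 2(m₁+m₂+m₃+m₄) ≤ 3d, if and only if it is a linear combination with nonnegative real coefficients of the twelve vectors (0, −e_i) for 1 ≤ i ≤ 4, (1, e_i) for 1 ≤ i ≤ 4, and (2, e_{i₁}+e_{i₂}+e_{i₃}) for all 1 ≤ i₁ < i₂ < i₃ ≤ 4, where e₁, …, e₄ are the standard basis vectors of the last four coordinates. -/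
/-- The `3`-element subsets of `Fin 4` are the complements of the singletons. -/
noncomputable def complSingletonEquiv : Fin 4 ≃ {S : Finset (Fin 4) // S.card = 3} :=
  Equiv.ofBijective (fun i => ⟨{i}ᶜ, by simp [Finset.card_compl]⟩) (by decide)

theorem mem_complSingletonEquiv (i j : Fin 4) : i ∈ (complSingletonEquiv j).1 ↔ i ≠ j := by
  simp [complSingletonEquiv]

/-- Replacing negative multiplicities by `0` preserves the defining inequalities. -/
theorem posPart_ineqs {d : ℝ} {m : Fin 4 → ℝ} (hd : 0 ≤ d) (hm : ∀ i, m i ≤ d)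
    (hmm : ∀ i j, i ≠ j → m i + m j ≤ d) (hsm : ∀ i, (∑ j, m j) + m i ≤ 2 * d)
    (hs : 2 * (∑ j, m j) ≤ 3 * d) :
    (∀ i j, i ≠ j → max (m i) 0 + max (m j) 0 ≤ d) ∧
      (∀ i, (∑ j, max (m j) 0) + max (m i) 0 ≤ 2 * d) ∧ 2 * (∑ j, max (m j) 0) ≤ 3 * d := by
  have hp : ∀ i j, i ≠ j → max (m i) 0 + max (m j) 0 ≤ d := by
    intro i j hij
    have := hmm i j hij
    have := hm i
    have := hm j
    rcases max_cases (m i) 0 with ei | ei <;> rcases max_cases (m j) 0 with ej | ej <;> linarith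
  by_cases hneg : ∀ i, 0 ≤ m i
  · simp only [max_eq_left (hneg _)]
    exact ⟨hmm, hsm, hs⟩
  · obtain ⟨k, hk⟩ := not_forall.mp hneg
    have hk0 : max (m k) 0 = 0 := max_eq_right (not_le.mp hk).le
    have hn : ∀ i, 0 ≤ max (m i) 0 := fun i => le_max_right _ _
    have h01 := hp 0 1 (by decide)
    have h02 := hp 0 2 (by decide)
    have h03 := hp 0 3 (by decide)
    have h12 := hp 1 2 (by decide)
    have h13 := hp 1 3 (by decide)
    have h23 := hp 2 3 (by decide)
    have h0 := hn 0
    have h1 := hn 1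
    have h2 := hn 2
    have h3 := hn 3
    simp only [Fin.sum_univ_four]
    refine ⟨hp, fun i => ?_, ?_⟩
    · fin_cases k <;> fin_cases i <;> simp only [Fin.zero_eta, Fin.mk_one, Fin.reduceFinMk] at * <;>
        linarith
    · fin_cases k <;> simp only [Fin.zero_eta, Fin.mk_one, Fin.reduceFinMk] at * <;> linarith

/-- The total deficiency of `p` below a level `C` is at most `C` as soon as it is so when summed
over each pair, each triple and the full index set. -/
theorem sum_max_sub_le {C : ℝ} {p : Fin 4 → ℝ} (hC : 0 ≤ C) (hp : ∀ i, 0 ≤ p i)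
    (h2 : ∀ i j, i ≠ j → C ≤ p i + p j) (h3 : ∀ i, 2 * C ≤ (∑ j, p j) - p i)
    (h4 : 3 * C ≤ ∑ j, p j) : ∑ i, max (C - p i) 0 ≤ C := by
  have h01 := h2 0 1 (by decide)
  have h02 := h2 0 2 (by decide)
  have h03 := h2 0 3 (by decide)
  have h12 := h2 1 2 (by decide)
  have h13 := h2 1 3 (by decide)
  have h23 := h2 2 3 (by decide)
  simp only [Fin.sum_univ_four] at *
  have hp0 := hp 0
  have hp1 := hp 1
  have hp2 := hp 2
  have hp3 := hp 3
  have t0 := h3 0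
  have t1 := h3 1
  have t2 := h3 2
  have t3 := h3 3
  rcases max_cases (C - p 0) 0 with e0 | e0 <;> rcases max_cases (C - p 1) 0 with e1 | e1 <;>
    rcases max_cases (C - p 2) 0 with e2 | e2 <;>
    rcases max_cases (C - p 3) 0 with e3 | e3 <;> linarith

/-- **The effective cone of the blow-up of `ℙ³` along 4 general lines (Theorem 5.3 + Cor. 5.7).**
A vector `(d, m₁, …, m₄) ∈ ℝ⁵` satisfies `0 ≤ d`; `mᵢ ≤ d` for all `i`; `mᵢ + mⱼ ≤ d` for all
`i ≠ j`; `(m₁+⋯+m₄) + mᵢ ≤ 2d` for all `i`; and `2(m₁+⋯+m₄) ≤ 3d`, if and only if it is a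
nonnegative linear combination of the twelve vectors `(0, −eᵢ)`, `(1, eᵢ)` (`1 ≤ i ≤ 4`) and
`(2, e_{i₁}+e_{i₂}+e_{i₃})` (`1 ≤ i₁ < i₂ < i₃ ≤ 4`); triples are encoded as 3-element subsets
`S` of `Fin 4`, with coefficient `c S`. -/
theorem effective_cone_four_lines (d : ℝ) (m : Fin 4 → ℝ) :
    (0 ≤ d ∧ (∀ i, m i ≤ d) ∧ (∀ i j, i ≠ j → m i + m j ≤ d) ∧
      (∀ i, (∑ j, m j) + m i ≤ 2 * d) ∧ 2 * (∑ j, m j) ≤ 3 * d) ↔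
    ∃ (a b : Fin 4 → ℝ) (c : {S : Finset (Fin 4) // S.card = 3} → ℝ),
      (∀ i, 0 ≤ a i) ∧ (∀ i, 0 ≤ b i) ∧ (∀ S, 0 ≤ c S) ∧
      d = (∑ i, b i) + 2 * ∑ S, c S ∧
      ∀ i, m i = -(a i) + b i + ∑ S, (if i ∈ S.1 then c S else 0) := by
  constructor
  · rintro ⟨hd, hm, hmm, hsm, hs⟩
    obtain ⟨hpp, hsp, hs'⟩ := posPart_ineqs hd hm hmm hsm hs
    have hmp : ∀ i, m i ≤ max (m i) 0 := fun i => le_max_left _ _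
    have hp : ∀ i, 0 ≤ max (m i) 0 := fun i => le_max_right _ _
    obtain ⟨p, hpi⟩ : ∃ p : Fin 4 → ℝ, ∀ i, max (m i) 0 = p i := ⟨_, fun _ => rfl⟩
    simp only [hpi] at hpp hsp hs' hmp hp
    obtain ⟨C, hC, hCs, hq⟩ : ∃ C : ℝ, 0 ≤ C ∧ (∑ j, p j) - d ≤ C ∧
        ∑ i, max (C - p i) 0 ≤ C := by
      rcases le_total (∑ j, p j) d with h | h
      · refine ⟨0, le_rfl, by linarith, ?_⟩
        simp [hp]
      · refine ⟨(∑ j, p j) - d, by linarith, le_rfl,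
          sum_max_sub_le (by linarith) hp (fun i j hij => ?_) (fun i => ?_) (by linarith)⟩
        · have h01 := hpp 0 1 (by decide)
          have h02 := hpp 0 2 (by decide)
          have h03 := hpp 0 3 (by decide)
          have h12 := hpp 1 2 (by decide)
          have h13 := hpp 1 3 (by decide)
          have h23 := hpp 2 3 (by decide)
          simp only [Fin.sum_univ_four]
          fin_cases i <;> fin_cases j <;>
            simp only [Fin.zero_eta, Fin.mk_one, Fin.reduceFinMk, ne_eq, not_true_eq_false] at * <;>
            linarith
        · linarith [hsp i]
    have hq0 : ∀ i, 0 ≤ max (C - p i) 0 := fun i => le_max_right _ _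
    have hqC : ∀ i, C - p i ≤ max (C - p i) 0 := fun i => le_max_left _ _
    obtain ⟨q, hqi⟩ : ∃ q : Fin 4 → ℝ, ∀ i, max (C - p i) 0 = q i := ⟨_, fun _ => rfl⟩
    simp only [hqi] at hq hq0 hqC
    let r : Fin 4 → ℝ := fun i => q i + if i = 0 then C - ∑ j, q j else 0
    have hqr : ∀ i, q i ≤ r i := fun i => by
      simp only [r]
      split_ifs <;> linarith
    have hr : ∑ i, r i = C := by simp [r, Finset.sum_add_distrib]
    let x : Fin 4 → ℝ := fun i => if i = 0 then d - (∑ j, p j) + C else 0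
    have hx : ∀ i, 0 ≤ x i := fun i => by
      simp only [x]
      split_ifs <;> linarith
    have hxs : ∑ i, x i = d - (∑ j, p j) + C := by simp [x]
    refine ⟨fun i => p i - m i + x i, fun i => p i - C + r i + x i,
      fun S => r (complSingletonEquiv.symm S), fun i => ?_, fun i => ?_, fun S => ?_, ?_,
      fun i => ?_⟩
    · linarith [hmp i, hx i]
    · linarith [hqC i, hqr i, hx i]
    · exact (hq0 _).trans (hqr _)
    · rw [Equiv.sum_comp complSingletonEquiv.symm r, hr]
      simp only [Finset.sum_add_distrib, Finset.sum_sub_distrib, hr, hxs]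
      simp
      ring
    · rw [← complSingletonEquiv.sum_comp]
      simp only [mem_complSingletonEquiv, Equiv.symm_apply_apply]
      have hsum : ∑ j, (if i ≠ j then r j else 0) = C - r i := by
        rw [← hr, ← Finset.sum_erase_eq_sub (Finset.mem_univ i), ← Finset.sum_filter]
        congr 1
        ext j
        simp [eq_comm]
      rw [hsum]
      ring
  · rintro ⟨a, b, c, ha, hb, hc, rfl, hm⟩
    simp only [← complSingletonEquiv.sum_comp, mem_complSingletonEquiv] at hm ⊢
    replace hc : ∀ i, 0 ≤ c (complSingletonEquiv i) := fun i => hc _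
    simp only [Fin.forall_fin_succ, Fin.sum_univ_four] at ha hb hc hm ⊢
    simp at ha hb hc hm ⊢
    obtain ⟨ha0, ha1, ha2, ha3⟩ := ha
    obtain ⟨hb0, hb1, hb2, hb3⟩ := hb
    obtain ⟨hc0, hc1, hc2, hc3⟩ := hc
    obtain ⟨hm0, hm1, hm2, hm3⟩ := hm
    refine ⟨?_, ⟨?_, ?_, ?_, ?_⟩, ?_, ⟨?_, ?_, ?_, ?_⟩, ?_⟩
    all_goals first
      | linarith
      | refine ⟨⟨?_, ?_, ?_⟩, ⟨?_, ?_, ?_⟩, ⟨?_, ?_, ?_⟩, ⟨?_, ?_, ?_⟩⟩ <;>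
          linarith
end

section
/- Let (d, m₁, …, m₅) ∈ ℝ⁶ with m_i ≥ 0 for all i ∈ {1,…,5}. Then the inequalities 0 ≤ d; m_i ≤ d for all i; m_i + m_j ≤ d for all i ≠ j; (m₁+⋯+m₅) + m_i − m_j ≤ 2d for all i ≠ j; (m₁+⋯+m₅) + m_i ≤ 2d for all i; and 2(m₁+⋯+m₅) ≤ 3d all hold if and only if (d, m₁, …, m₅) is a linear combination with nonnegative real coefficients of the twenty vectors (0, −e_i) for 1 ≤ i ≤ 5, (1, e_i) for 1 ≤ i ≤ 5, and (2, e_{i₁}+e_{i₂}+e_{i₃}) for all 1 ≤ i₁ < i₂ < i₃ ≤ 5, where e₁, …, e₅ are the standard basis vectors of the last five coordinates. -/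
/-- `(d, m)` is a nonnegative combination of the classes `Eᵢ`, `H - Eᵢ` and
`2H - E_{i₁} - E_{i₂} - E_{i₃}`. -/
def InFiveLinesCone (d : ℝ) (m : Fin 5 → ℝ) : Prop :=
  ∃ (a b : Fin 5 → ℝ) (c : {S : Finset (Fin 5) // S.card = 3} → ℝ),
    (∀ i, 0 ≤ a i) ∧ (∀ i, 0 ≤ b i) ∧ (∀ S, 0 ≤ c S) ∧
    d = (∑ i, b i) + 2 * ∑ S, c S ∧
    ∀ i, m i = -(a i) + b i + ∑ S, (if i ∈ S.1 then c S else 0)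

namespace InFiveLinesCone

theorem add {d d' : ℝ} {m m' : Fin 5 → ℝ} (h : InFiveLinesCone d m)
    (h' : InFiveLinesCone d' m') : InFiveLinesCone (d + d') (m + m') := by
  obtain ⟨a, b, c, ha, hb, hc, hd, hm⟩ := h
  obtain ⟨a', b', c', ha', hb', hc', hd', hm'⟩ := h'
  refine ⟨a + a', b + b', c + c', fun i => add_nonneg (ha i) (ha' i),
    fun i => add_nonneg (hb i) (hb' i), fun S => add_nonneg (hc S) (hc' S), ?_, fun i => ?_⟩
  · simp only [Pi.add_apply, Finset.sum_add_distrib]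
    linarith
  · have hsum : ∑ S : {S : Finset (Fin 5) // S.card = 3}, (if i ∈ S.1 then (c + c') S else 0) =
        (∑ S, if i ∈ S.1 then c S else 0) + ∑ S, if i ∈ S.1 then c' S else 0 := by
      rw [← Finset.sum_add_distrib]
      refine Finset.sum_congr rfl fun S _ => ?_
      split_ifs <;> simp
    rw [hsum]
    simp only [Pi.add_apply, hm i, hm' i]
    ring

theorem of_nonneg {b : Fin 5 → ℝ} (hb : ∀ i, 0 ≤ b i) : InFiveLinesCone (∑ i, b i) b :=
  ⟨0, b, 0, fun _ => le_rfl, hb, fun _ => le_rfl, by simp, by simp⟩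

theorem triple {S : Finset (Fin 5)} (hS : S.card = 3) {r : ℝ} (hr : 0 ≤ r) :
    InFiveLinesCone (2 * r) (fun i => if i ∈ S then r else 0) := by
  refine ⟨0, 0, Pi.single ⟨S, hS⟩ r, fun _ => le_rfl, fun _ => le_rfl, fun T => ?_, by simp,
    fun i => ?_⟩
  · have h : (0 : {S : Finset (Fin 5) // S.card = 3} → ℝ) ≤ Pi.single ⟨S, hS⟩ r :=
      Pi.single_nonneg.2 hr
    exact h T
  · rw [Finset.sum_eq_single ⟨S, hS⟩]
    · simp
    · intro T _ hT
      simp [Pi.single_eq_of_ne hT]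
    · simp

theorem mono {d d' : ℝ} {m : Fin 5 → ℝ} (h : InFiveLinesCone d m) (hd : d ≤ d') :
    InFiveLinesCone d' m := by
  obtain ⟨a, b, c, ha, hb, hc, rfl, hm⟩ := h
  set e := d' - (∑ i, b i + 2 * ∑ S, c S) with he
  have h0 : (0 : Fin 5 → ℝ) ≤ Pi.single 0 e := Pi.single_nonneg.2 (sub_nonneg.2 hd)
  refine ⟨a + Pi.single 0 e, b + Pi.single 0 e, c, fun i => add_nonneg (ha i) (h0 i),
    fun i => add_nonneg (hb i) (h0 i), hc, ?_, fun i => ?_⟩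
  · simp only [Pi.add_apply, Finset.sum_add_distrib, Finset.sum_pi_single', Finset.mem_univ,
      if_true]
    linarith
  · rw [hm i]
    simp only [Pi.add_apply]
    ring

theorem of_comp_perm {d : ℝ} {m : Fin 5 → ℝ} (σ : Equiv.Perm (Fin 5))
    (h : InFiveLinesCone d (m ∘ σ)) : InFiveLinesCone d m := by
  obtain ⟨a, b, c, ha, hb, hc, hd, hm⟩ := h
  let e : {S : Finset (Fin 5) // S.card = 3} ≃ {S : Finset (Fin 5) // S.card = 3} :=
    (Equiv.finsetCongr σ.symm).subtypeEquiv fun S => by simp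
  refine ⟨a ∘ σ.symm, b ∘ σ.symm, c ∘ e, fun i => ha _, fun i => hb _, fun S => hc _, ?_,
    fun i => ?_⟩
  · rw [hd, ← Equiv.sum_comp σ.symm b, ← Equiv.sum_comp e c]
    rfl
  · have hi := hm (σ.symm i)
    rw [← Equiv.sum_comp e] at hi
    simpa [e] using hi

/-- The cone over the hypersimplex: a decreasing nonnegative vector whose entries are at most a
third `t` of their sum is a nonnegative combination of indicators of triples of total weight `t`. -/
theorem of_antitone_of_sum_eq {u : Fin 5 → ℝ} {t : ℝ} (hu : Antitone u) (h0 : 0 ≤ u 4)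
    (ht : u 0 ≤ t) (hsum : ∑ i, u i = 3 * t) : InFiveLinesCone (2 * t) u := by
  have h01 : u 1 ≤ u 0 := hu (by decide)
  have h12 : u 2 ≤ u 1 := hu (by decide)
  have h23 : u 3 ≤ u 2 := hu (by decide)
  have h34 : u 4 ≤ u 3 := hu (by decide)
  rw [Fin.sum_univ_five] at hsum
  -- After removing `t - u 0` copies of `{1, 2, 3}`, all remaining triples contain `0`, and the
  -- problem becomes one about the octahedron of pairs in `{1, 2, 3, 4}`.
  obtain ⟨p, hp⟩ : ∃ p, p = u 1 + u 2 - 2 * t + u 0 := ⟨_, rfl⟩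
  obtain ⟨q, hq⟩ : ∃ q, q = u 1 + u 3 - 2 * t + u 0 := ⟨_, rfl⟩
  obtain ⟨r, hr⟩ : ∃ r, r = u 1 + u 4 - t := ⟨_, rfl⟩
  have hs : |p| + |q| + |r| ≤ u 0 := by
    rcases abs_cases p with ⟨h, _⟩ | ⟨h, _⟩ <;> rcases abs_cases q with ⟨h', _⟩ | ⟨h', _⟩ <;>
      rcases abs_cases r with ⟨h'', _⟩ | ⟨h'', _⟩ <;> rw [h, h', h''] <;> linarith
  have hp₁ := neg_abs_le p
  have hp₂ := le_abs_self p
  have hq₁ := neg_abs_le q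
  have hq₂ := le_abs_self q
  have hr₁ := neg_abs_le r
  have hr₂ := le_abs_self r
  have key :=
    ((((((triple (S := {1, 2, 3}) rfl (sub_nonneg.2 ht)).add
    (triple (S := {0, 1, 2}) (r := (p + u 0 - |q| - |r|) / 2) rfl (by linarith))).add
    (triple (S := {0, 3, 4}) (r := (-p + u 0 - |q| - |r|) / 2) rfl (by linarith))).add
    (triple (S := {0, 1, 3}) (r := (|q| + q) / 2) rfl (by linarith))).add
    (triple (S := {0, 2, 4}) (r := (|q| - q) / 2) rfl (by linarith))).add
    (triple (S := {0, 1, 4}) (r := (|r| + r) / 2) rfl (by linarith))).add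
    (triple (S := {0, 2, 3}) (r := (|r| - r) / 2) rfl (by linarith))
  convert key using 1
  · ring
  · ext i
    fin_cases i <;> simp <;> linarith

theorem of_antitone {d : ℝ} {m : Fin 5 → ℝ} (hm : Antitone m) (h0 : 0 ≤ m 4)
    (h₂ : m 0 + m 1 ≤ d) (h₁ : (∑ i, m i) + m 0 ≤ 2 * d) (h : 2 * ∑ i, m i ≤ 3 * d) :
    InFiveLinesCone d m := by
  have h01 : m 1 ≤ m 0 := hm (by decide)
  have h12 : m 2 ≤ m 1 := hm (by decide)
  have h23 : m 3 ≤ m 2 := hm (by decide)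
  have h34 : m 4 ≤ m 3 := hm (by decide)
  -- Subtracting a vector supported on the first two coordinates reduces to the hypersimplex.
  have reduce : ∀ x y t : ℝ, 0 ≤ x → 0 ≤ y → m 1 - y ≤ m 0 - x → m 2 ≤ m 1 - y → m 0 - x ≤ t →
      m 0 - x + (m 1 - y) + m 2 + m 3 + m 4 = 3 * t → x + y + 2 * t ≤ d →
      InFiveLinesCone d m := by
    intro x y t hx hy hxy hy₂ ht hsum hd
    have hu : InFiveLinesCone (2 * t) ![m 0 - x, m 1 - y, m 2, m 3, m 4] := by
      refine of_antitone_of_sum_eq (Fin.antitone_iff_succ_le.2 fun i => ?_) h0 ht ?_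
      · fin_cases i
        exacts [hxy, hy₂, h23, h34]
      · simpa [Fin.sum_univ_five] using hsum
    have hb : InFiveLinesCone (∑ i, ![x, y, 0, 0, 0] i) ![x, y, 0, 0, 0] :=
      of_nonneg fun i => by fin_cases i <;> simp [hx, hy]
    have hm' : ![x, y, 0, 0, 0] + ![m 0 - x, m 1 - y, m 2, m 3, m 4] = m := by
      ext i
      fin_cases i <;> simp
    rw [← hm']
    refine (hb.add hu).mono ?_
    simpa [Fin.sum_univ_five] using hd
  rw [Fin.sum_univ_five] at h₁ h
  rcases le_total (3 * m 0) (m 0 + m 1 + m 2 + m 3 + m 4) with hc | hc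
  · apply reduce 0 0 ((m 0 + m 1 + m 2 + m 3 + m 4) / 3) <;> linarith
  rcases le_total (m 1) (m 2 + m 3 + m 4) with hc' | hc'
  · apply reduce (m 0 - (m 1 + m 2 + m 3 + m 4) / 2) 0 ((m 1 + m 2 + m 3 + m 4) / 2) <;> linarith
  · apply reduce (m 0 - (m 2 + m 3 + m 4)) (m 1 - (m 2 + m 3 + m 4)) (m 2 + m 3 + m 4) <;>
      linarith

end InFiveLinesCone

/-- **The effective cone of the blow-up of `ℙ³` along 5 general lines (Theorem 5.5 + Cor. 5.7),
on the orthant of nonnegative multiplicities.**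
Let `(d, m₁, …, m₅) ∈ ℝ⁶` with all `mᵢ ≥ 0`. Then `0 ≤ d`; `mᵢ ≤ d` for all `i`;
`mᵢ + mⱼ ≤ d` for all `i ≠ j`; `(m₁+⋯+m₅) + mᵢ − mⱼ ≤ 2d` for all `i ≠ j`;
`(m₁+⋯+m₅) + mᵢ ≤ 2d` for all `i`; and `2(m₁+⋯+m₅) ≤ 3d` all hold if and only if
`(d, m₁, …, m₅)` is a nonnegative linear combination of the twenty vectors `(0, −eᵢ)`,
`(1, eᵢ)` (`1 ≤ i ≤ 5`) and `(2, e_{i₁}+e_{i₂}+e_{i₃})` (`1 ≤ i₁ < i₂ < i₃ ≤ 5`); triples are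
encoded as 3-element subsets `S` of `Fin 5`, with coefficient `c S`. -/
theorem effective_cone_five_lines (d : ℝ) (m : Fin 5 → ℝ) (hm : ∀ i, 0 ≤ m i) :
    (0 ≤ d ∧ (∀ i, m i ≤ d) ∧ (∀ i j, i ≠ j → m i + m j ≤ d) ∧
      (∀ i j, i ≠ j → (∑ l, m l) + m i - m j ≤ 2 * d) ∧
      (∀ i, (∑ l, m l) + m i ≤ 2 * d) ∧ 2 * (∑ l, m l) ≤ 3 * d) ↔
    ∃ (a b : Fin 5 → ℝ) (c : {S : Finset (Fin 5) // S.card = 3} → ℝ),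
      (∀ i, 0 ≤ a i) ∧ (∀ i, 0 ≤ b i) ∧ (∀ S, 0 ≤ c S) ∧
      d = (∑ i, b i) + 2 * ∑ S, c S ∧
      ∀ i, m i = -(a i) + b i + ∑ S, (if i ∈ S.1 then c S else 0) := by
  constructor
  · rintro ⟨-, -, h₂, -, h₁, h⟩
    have hanti : Antitone (m ∘ Tuple.sort (OrderDual.toDual ∘ m)) :=
      Tuple.monotone_sort (OrderDual.toDual ∘ m)
    set σ := Tuple.sort (OrderDual.toDual ∘ m)
    have hsum : ∑ i, (m ∘ σ) i = ∑ i, m i := Equiv.sum_comp σ m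
    exact InFiveLinesCone.of_comp_perm σ <| InFiveLinesCone.of_antitone hanti (hm _)
      (h₂ _ _ (σ.injective.ne (by decide))) (hsum ▸ h₁ _) (hsum ▸ h)
  · rintro ⟨a, b, c, ha, hb, hc, hd, hmi⟩
    have hA : ∀ i, a i ≤ ∑ l, a l := fun i =>
      Finset.single_le_sum (fun l _ => ha l) (Finset.mem_univ i)
    have hB : ∀ i, b i ≤ ∑ l, b l := fun i =>
      Finset.single_le_sum (fun l _ => hb l) (Finset.mem_univ i)
    have hB₂ : ∀ i j, i ≠ j → b i + b j ≤ ∑ l, b l := fun i j hij =>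
      Finset.add_le_sum (fun l _ => hb l) (Finset.mem_univ i) (Finset.mem_univ j) hij
    have hC : 0 ≤ ∑ S, c S := Finset.sum_nonneg fun S _ => hc S
    have hX₀ : ∀ i, 0 ≤ ∑ S, (if i ∈ S.1 then c S else 0) := fun i =>
      Finset.sum_nonneg fun S _ => by split_ifs <;> simp [hc S]
    have hX : ∀ i, ∑ S, (if i ∈ S.1 then c S else 0) ≤ ∑ S, c S := fun i =>
      Finset.sum_le_sum fun S _ => by split_ifs <;> simp [hc S]
    have hsum : ∑ l, m l = -(∑ l, a l) + ∑ l, b l + 3 * ∑ S, c S := by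
      have hswap : ∑ l, ∑ S, (if l ∈ S.1 then c S else 0) = 3 * ∑ S, c S := by
        rw [Finset.sum_comm, Finset.mul_sum]
        refine Finset.sum_congr rfl fun S _ => ?_
        simp [S.2]
      simp only [hmi, Finset.sum_add_distrib, Finset.sum_neg_distrib, hswap]
    have hA₀ : 0 ≤ ∑ l, a l := Finset.sum_nonneg fun l _ => ha l
    have hB₀ : 0 ≤ ∑ l, b l := Finset.sum_nonneg fun l _ => hb l
    refine ⟨by linarith, fun i => ?_, fun i j hij => ?_, fun i j _ => ?_, fun i => ?_,
      by linarith⟩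
    · linarith [hmi i, ha i, hB i, hX i]
    · linarith [hmi i, hmi j, ha i, ha j, hB₂ i j hij, hX i, hX j]
    · linarith [hmi i, hmi j, ha i, hA j, hB i, hb j, hX i, hX₀ j]
    · linarith [hmi i, ha i, hB i, hX i]
end

section
/- Let C ⊆ ℝ³ be the set of all linear combinations with nonnegative real coefficients of the four vectors (0, −1, 0), (0, 0, −1), (1, 1, 0), (1, 0, 1). Then each of these four vectors spans an extremal ray of C; that is, for each such vector v, whenever x, y ∈ C and x + y is a nonnegative multiple of v, both x and y are nonnegative multiples of v. -/
/-- The effective cone of the blow-up of `ℙ³` along 2 general lines: all nonnegative linear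
combinations of `(0,−1,0)`, `(0,0,−1)`, `(1,1,0)`, `(1,0,1)` (the classes `E₁, E₂, H−E₁, H−E₂`
in coordinates `(d, m₁, m₂)`). -/
def effConeTwoLines : Set (Fin 3 → ℝ) :=
  {x | ∃ a b c e : ℝ, 0 ≤ a ∧ 0 ≤ b ∧ 0 ≤ c ∧ 0 ≤ e ∧
    x = a • ![0, -1, 0] + b • ![0, 0, -1] + c • ![1, 1, 0] + e • ![1, 0, 1]}

/-- **Extremal rays of `Eff(X₂)` (Corollary 5.6).**
Each of the four generating vectors spans an extremal ray of the cone: whenever `x, y` in the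
cone are such that `x + y` is a nonnegative multiple of the generator `v`, both `x` and `y`
are nonnegative multiples of `v`. -/
theorem extremal_rays_two_lines :
    ∀ v ∈ ({![0, -1, 0], ![0, 0, -1], ![1, 1, 0], ![1, 0, 1]} : Set (Fin 3 → ℝ)),
      ∀ x ∈ effConeTwoLines, ∀ y ∈ effConeTwoLines,
        (∃ t : ℝ, 0 ≤ t ∧ x + y = t • v) →
        (∃ t : ℝ, 0 ≤ t ∧ x = t • v) ∧ (∃ t : ℝ, 0 ≤ t ∧ y = t • v) := by
  rintro v hv x ⟨a, b, c, e, ha, hb, hc, he, rfl⟩ y ⟨a', b', c', e', ha', hb', hc', he', rfl⟩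
    ⟨t, ht, h⟩
  have h0 := congrFun h 0
  have h1 := congrFun h 1
  have h2 := congrFun h 2
  rcases hv with rfl | rfl | rfl | rfl <;> simp at h0 h1 h2
  · obtain ⟨rfl, rfl, rfl, rfl, rfl, rfl⟩ :
        b = 0 ∧ c = 0 ∧ e = 0 ∧ b' = 0 ∧ c' = 0 ∧ e' = 0 := by
      refine ⟨?_, ?_, ?_, ?_, ?_, ?_⟩ <;> linarith
    exact ⟨⟨a, ha, by simp⟩, ⟨a', ha', by simp⟩⟩
  · obtain ⟨rfl, rfl, rfl, rfl, rfl, rfl⟩ :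
        a = 0 ∧ c = 0 ∧ e = 0 ∧ a' = 0 ∧ c' = 0 ∧ e' = 0 := by
      refine ⟨?_, ?_, ?_, ?_, ?_, ?_⟩ <;> linarith
    exact ⟨⟨b, hb, by simp⟩, ⟨b', hb', by simp⟩⟩
  · obtain ⟨rfl, rfl, rfl, rfl, rfl, rfl⟩ :
        a = 0 ∧ b = 0 ∧ e = 0 ∧ a' = 0 ∧ b' = 0 ∧ e' = 0 := by
      refine ⟨?_, ?_, ?_, ?_, ?_, ?_⟩ <;> linarith
    exact ⟨⟨c, hc, by simp⟩, ⟨c', hc', by simp⟩⟩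
  · obtain ⟨rfl, rfl, rfl, rfl, rfl, rfl⟩ :
        a = 0 ∧ b = 0 ∧ c = 0 ∧ a' = 0 ∧ b' = 0 ∧ c' = 0 := by
      refine ⟨?_, ?_, ?_, ?_, ?_, ?_⟩ <;> linarith
    exact ⟨⟨e, he, by simp⟩, ⟨e', he', by simp⟩⟩
end

section
/- Let d, m₁, m₂, m₃, m₄ be real numbers with m_i ≥ 0 for all i, satisfying 0 ≤ d; m_i + m_j ≤ d for all i ≠ j in {1,…,4}; (m₁+m₂+m₃+m₄) + m_i ≤ 2d for all i; and 2(m₁+m₂+m₃+m₄) ≤ 3d. Set k := m₁ + m₂ + m₃ − d and suppose k > 0. Then the vector (d′, m₁′, m₂′, m₃′, m₄′) := (d − 2k, m₁ − k, m₂ − k, m₃ − k, m₄) again has all m_i′ ≥ 0 and satisfies the same system of inequalities: 0 ≤ d′; m_i′ + m_j′ ≤ d′ for all i ≠ j; (m₁′+m₂′+m₃′+m₄′) + m_i′ ≤ 2d′ for all i; and 2(m₁′+m₂′+m₃′+m₄′) ≤ 3d′. -/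
/-- **Reduction step in the proof of Theorem 5.3 (four lines).**
Let `(d, m₁, …, m₄)` with all `mᵢ ≥ 0` satisfy `0 ≤ d`; `mᵢ + mⱼ ≤ d` for `i ≠ j`;
`(m₁+⋯+m₄) + mᵢ ≤ 2d` for all `i`; and `2(m₁+⋯+m₄) ≤ 3d`. If `k := m₁ + m₂ + m₃ − d > 0`,
then `(d − 2k, m₁ − k, m₂ − k, m₃ − k, m₄)` again has nonnegative multiplicities and
satisfies the same system of inequalities. -/
theorem reduction_step_four_lines (d k : ℝ) (m : Fin 4 → ℝ)
    (hm : ∀ i, 0 ≤ m i) (hd : 0 ≤ d)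
    (hpair : ∀ i j, i ≠ j → m i + m j ≤ d)
    (hsum : ∀ i, (∑ j, m j) + m i ≤ 2 * d)
    (h2 : 2 * (∑ j, m j) ≤ 3 * d)
    (hk : k = m 0 + m 1 + m 2 - d) (hkpos : 0 < k)
    (d' : ℝ) (m' : Fin 4 → ℝ)
    (hd' : d' = d - 2 * k)
    (hm' : m' = ![m 0 - k, m 1 - k, m 2 - k, m 3]) :
    (∀ i, 0 ≤ m' i) ∧ 0 ≤ d' ∧ (∀ i j, i ≠ j → m' i + m' j ≤ d') ∧
      (∀ i, (∑ j, m' j) + m' i ≤ 2 * d') ∧ 2 * (∑ j, m' j) ≤ 3 * d' := by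
  subst hd' hm' hk
  simp only [Fin.sum_univ_four] at hsum h2
  have h01 := hpair 0 1 (by decide)
  have h02 := hpair 0 2 (by decide)
  have h12 := hpair 1 2 (by decide)
  have hs0 := hsum 0
  have hs1 := hsum 1
  have hs2 := hsum 2
  have hm3 := hm 3
  refine ⟨fun i => ?_, by linarith, fun i j hij => ?_, fun i => ?_, ?_⟩
  · fin_cases i <;> simp <;> linarith
  · fin_cases i <;> fin_cases j <;> simp at hij ⊢ <;> linarith
  · fin_cases i <;> simp [Fin.sum_univ_four] <;> linarith
  · simp [Fin.sum_univ_four]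
    linarith
end
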